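/- Let q > 3 be a prime power. For every integer m ≥ 1, the number of cosets of the code C_m in F_{q^m}^{q+1} whose coset weight equals 3 is α_3(q^m) = (q^m − 1) · [ (1/2) q (q+1)^2 + (1/6) q (q+1)(q−1) · ( q^{2m} + q^m + 1 − (q^2 + q + 1)(q^m − q + 1) ) + μ_q · (q^m − q) ]. -/

import Mathlib

open Submodule Module

noncomputable section

def cubicPts (F : Type) [Field F] : Set (Submodule F (Fin 4 → F)) :=
  {P | (∃ t : F, P = span F {![t ^ 3, t ^ 2, t, 1]}) ∨ P = span F {![1, 0, 0, 0]}}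

def ptsOn (F : Type) [Field F] (W : Submodule F (Fin 4 → F)) :
    Set (Submodule F (Fin 4 → F)) :=
  {P | P ∈ cubicPts F ∧ P ≤ W}

def IsThreePlane (F : Type) [Field F] (W : Submodule F (Fin 4 → F)) : Prop :=
  finrank F W = 3 ∧ (ptsOn F W).ncard = 3

def IsRealChord (F : Type) [Field F] (L : Submodule F (Fin 4 → F)) : Prop :=
  finrank F L = 2 ∧ ∃ P Q, P ∈ cubicPts F ∧ Q ∈ cubicPts F ∧ P ≠ Q ∧ P ≤ L ∧ Q ≤ L

def muSet (F : Type) [Field F] : Set (Submodule F (Fin 4 → F)) :=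
  {L | finrank F L = 2 ∧ ¬ IsRealChord F L ∧ ∃ W, IsThreePlane F W ∧ L ≤ W}

def Hmat (F : Type) [Field F] : Matrix (Fin 4) (Option F) F :=
  fun i j => Option.elim j (![0, 0, 0, 1] i) (fun t => ![1, t, t ^ 2, t ^ 3] i)

def codeC (F : Type) [Field F] [Fintype F] (K : Type) [Field K] [Algebra F K] :
    Submodule K (Option F → K) :=
  LinearMap.ker (Matrix.mulVecLin ((Hmat F).map (algebraMap F K)))

def cosetWeight (F : Type) [Field F] [Fintype F] (K : Type) [Field K] [Algebra F K]
    (x : (Option F → K) ⧸ codeC F K) : ℕ :=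
  sInf {n | ∃ v : Option F → K, Submodule.Quotient.mk v = x ∧ {j | v j ≠ 0}.ncard = n}

/-- The column of the parity-check matrix at index `t`. -/
def pcol (F : Type) [Field F] (t : Option F) : Fin 4 → F := fun i => Hmat F i t

/-- Span of the columns indexed by `T`. -/
def spT (F : Type) [Field F] (T : Finset (Option F)) : Submodule F (Fin 4 → F) :=
  span F (pcol F '' (T : Set (Option F)))

theorem pcol_some (F : Type) [Field F] (t : F) : pcol F (some t) = ![1, t, t ^ 2, t ^ 3] := by
  ext i; simp [pcol, Hmat]

theorem pcol_none (F : Type) [Field F] : pcol F none = ![0, 0, 0, 1] := by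
  ext i; simp [pcol, Hmat]

/-- functional attached to a polynomial -/
def polyFun (F : Type) [Field F] (f : Polynomial F) : (Fin 4 → F) →ₗ[F] F :=
  ∑ i : Fin 4, f.coeff i • LinearMap.proj i

theorem polyFun_some (F : Type) [Field F] (f : Polynomial F) (hf : f.natDegree < 4) (t : F) :
    polyFun F f (pcol F (some t)) = f.eval t := by
  rw [Polynomial.eval_eq_sum_range' hf, pcol_some]
  simp [polyFun, Fin.sum_univ_four, Finset.sum_range_succ]

theorem polyFun_none (F : Type) [Field F] (f : Polynomial F) :
    polyFun F f (pcol F none) = f.coeff 3 := by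
  rw [pcol_none]
  simp [polyFun, Fin.sum_univ_four]

open Polynomial in
theorem sepT (F : Type) [Field F] (t0 : Option F) (T : Finset (Option F)) (h : t0 ∉ T)
    (hc : T.card ≤ 3) :
    ∃ φ : (Fin 4 → F) →ₗ[F] F, (∀ t ∈ T, φ (pcol F t) = 0) ∧ φ (pcol F t0) ≠ 0 := by
  classical
  set T' : Finset F := T.eraseNone with hT'
  have hmem : ∀ t : F, t ∈ T' ↔ some t ∈ T := by intro t; simp [hT']
  set g : F[X] := ∏ t ∈ T', (X - C t) with hg
  have hgm : g.Monic := monic_prod_of_monic _ _ (fun t _ => monic_X_sub_C t)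
  have hgd : g.natDegree = T'.card := by
    rw [hg, natDegree_prod_of_monic _ _ (fun t _ => monic_X_sub_C t)]; simp
  have hge : ∀ t : F, g.eval t = 0 ↔ t ∈ T' := by
    intro t
    rw [hg, eval_prod, Finset.prod_eq_zero_iff]
    simp only [eval_sub, eval_X, eval_C, sub_eq_zero]
    constructor
    · rintro ⟨a, ha, rfl⟩; exact ha
    · intro ht; exact ⟨t, ht, rfl⟩
  have hcard : T'.card ≤ T.card := Finset.card_eraseNone_le _
  cases t0 with
  | some a =>
    refine ⟨polyFun F g, ?_, ?_⟩
    · intro t ht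
      cases t with
      | some t => rw [polyFun_some F g (by omega), hge, hmem]; exact ht
      | none =>
        rw [polyFun_none]
        apply coeff_eq_zero_of_natDegree_lt
        have : T'.card + 1 = T.card := by
          rw [hT', Finset.card_eraseNone_of_mem ht]
          have := Finset.card_pos.mpr ⟨_, ht⟩
          omega
        omega
    · rw [polyFun_some F g (by omega), Ne, hge, hmem]; exact h
  | none =>
    have hd : (g * X ^ (3 - T'.card)).natDegree = 3 := by
      rw [hgm.natDegree_mul (monic_X_pow _), natDegree_X_pow, hgd]; omega
    refine ⟨polyFun F (g * X ^ (3 - T'.card)), ?_, ?_⟩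
    · intro t ht
      cases t with
      | some t =>
        rw [polyFun_some F _ (by omega), eval_mul, (hge t).2 ((hmem t).2 ht), zero_mul]
      | none => exact absurd ht h
    · rw [polyFun_none]
      have := (hgm.mul (monic_X_pow (3 - T'.card))).coeff_natDegree
      rw [hd] at this
      rw [this]; exact one_ne_zero

theorem pcol_mem (F : Type) [Field F] {t : Option F} {T : Finset (Option F)} (h : t ∈ T) :
    pcol F t ∈ spT F T := subset_span ⟨t, h, rfl⟩

theorem pcol_mem_iff (F : Type) [Field F] (t : Option F) (T : Finset (Option F))
    (hc : T.card ≤ 3) : pcol F t ∈ spT F T ↔ t ∈ T := by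
  constructor
  · intro h
    by_contra hn
    obtain ⟨φ, h1, h2⟩ := sepT F t T hn hc
    apply h2
    have : spT F T ≤ LinearMap.ker φ := by
      rw [spT, span_le]
      rintro _ ⟨s, hs, rfl⟩
      exact h1 s hs
    exact this h
  · exact pcol_mem F

theorem indepT (F : Type) [Field F] (T : Finset (Option F)) (hc : T.card ≤ 4) :
    LinearIndepOn F (pcol F) (T : Set (Option F)) := by
  classical
  rw [linearIndepOn_finset_iff]
  intro c hs i hi
  obtain ⟨φ, h1, h2⟩ := sepT F i (T.erase i) (by simp)
    (by rw [Finset.card_erase_of_mem hi]; omega)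
  have := congrArg φ hs
  rw [map_sum, map_zero, Finset.sum_eq_single i] at this
  · simpa [h2] using this
  · intro b hb hne
    simp [h1 b (Finset.mem_erase.2 ⟨hne, hb⟩)]
  · intro h; exact absurd hi h

theorem finrank_spT (F : Type) [Field F] (T : Finset (Option F)) (hc : T.card ≤ 4) :
    finrank F (spT F T) = T.card := by
  have h := finrank_span_eq_card (R := F) (indepT F T hc)
  have e : Set.range (fun x : (T : Set (Option F)) => pcol F x) = pcol F '' (T : Set (Option F)) := by
    ext; simp
  rw [e] at h
  rw [spT, h]; simp

theorem finrank_spT_le (F : Type) [Field F] (T : Finset (Option F))  :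
    finrank F (spT F T) ≤ T.card := by
  classical
  have := finrank_span_finset_le_card (R := F) (T.image (pcol F))
  rw [Finset.coe_image] at this
  exact this.trans Finset.card_image_le

theorem spT_mono (F : Type) [Field F] {T U : Finset (Option F)} (h : T ⊆ U) :
    spT F T ≤ spT F U := span_mono (Set.image_mono (by exact_mod_cast h))

theorem exists_ne2 (F : Type) [Field F] [Fintype F] (hq3 : 3 < Fintype.card F) (D : F) :
    ∃ a : F, a ≠ 0 ∧ a ^ 2 ≠ D := by
  classical
  by_contra hcon
  push Not at hcon
  by_cases h : ∃ r : F, r ^ 2 = D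
  · obtain ⟨r, hr⟩ := h
    have : (Finset.univ : Finset F) ⊆ {0, r, -r} := by
      intro a _
      by_cases ha : a = 0
      · simp [ha]
      · have := hcon a ha
        rw [← hr, sq_eq_sq_iff_eq_or_eq_neg] at this
        simp; tauto
    have := (Finset.card_le_card this).trans Finset.card_le_three
    rw [Finset.card_univ] at this; omega
  · exact h ⟨1, hcon 1 one_ne_zero⟩

theorem exists_half (F : Type) [Field F] [Fintype F] (hq3 : 3 < Fintype.card F) (c : F)
    (hc : c ≠ 0) : ∃ t : F, t ≠ 0 ∧ t ≠ c ∧ 2 * t ≠ c := by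
  classical
  obtain ⟨t, -, ht⟩ := Finset.exists_mem_notMem_of_card_lt_card
    (s := ({0, c, c / 2} : Finset F)) (t := Finset.univ)
    (by rw [Finset.card_univ]; exact Finset.card_le_three.trans_lt hq3)
  simp only [Finset.mem_insert, Finset.mem_singleton, not_or] at ht
  refine ⟨t, ht.1, ht.2.1, fun h => ?_⟩
  by_cases h2 : (2 : F) = 0
  · rw [h2, zero_mul] at h; exact hc h.symm
  · exact ht.2.2 (by rw [← h]; field_simp)

theorem comb_mem (F : Type) [Field F] (a b c : Option F) (x y z : F) (v : Fin 4 → F)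
    (h : v = x • pcol F a + y • pcol F b + z • pcol F c) :
    ∃ T : Finset (Option F), T.card ≤ 3 ∧ v ∈ spT F T := by
  classical
  refine ⟨{a, b, c}, Finset.card_le_three, ?_⟩
  rw [h]
  refine add_mem (add_mem ?_ ?_) ?_ <;>
  · apply smul_mem; apply pcol_mem; simp

theorem coverT (F : Type) [Field F] [Fintype F] (hq3 : 3 < Fintype.card F) (v : Fin 4 → F) :
    ∃ T : Finset (Option F), T.card ≤ 3 ∧ v ∈ spT F T := by
  classical
  obtain ⟨s0, s1, s2, s3, rfl⟩ : ∃ s0 s1 s2 s3, v = ![s0, s1, s2, s3] :=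
    ⟨v 0, v 1, v 2, v 3, by ext i; fin_cases i <;> rfl⟩
  -- points `t ≠ x` and `∞`
  have inf : ∀ t x : F, t ≠ x → s2 - (t + x) * s1 + t * x * s0 = 0 →
      ∃ T : Finset (Option F), T.card ≤ 3 ∧ ![s0, s1, s2, s3] ∈ spT F T := by
    intro t x htx h
    have h' : t - x ≠ 0 := sub_ne_zero.2 htx
    refine comb_mem F (some t) (some x) none ((s1 - x * s0) / (t - x)) ((t * s0 - s1) / (t - x))
      (s3 - (s1 - x * s0) / (t - x) * t ^ 3 - (t * s0 - s1) / (t - x) * x ^ 3) _ ?_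
    rw [pcol_some, pcol_some, pcol_none]
    ext i
    fin_cases i
    · simp; field_simp; ring
    · simp; field_simp; ring
    · simp; field_simp; linear_combination (t - x) * h
    · simp
  -- points `t ≠ x`, both nonzero, and `0`
  have zer : ∀ t x : F, t ≠ x → t ≠ 0 → x ≠ 0 → s3 - (t + x) * s2 + t * x * s1 = 0 →
      ∃ T : Finset (Option F), T.card ≤ 3 ∧ ![s0, s1, s2, s3] ∈ spT F T := by
    intro t x htx ht hx h
    have h' : t - x ≠ 0 := sub_ne_zero.2 htx
    refine comb_mem F (some t) (some x) (some 0) ((s2 - x * s1) / (t - x) / t)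
      ((t * s1 - s2) / (t - x) / x)
      (s0 - (s2 - x * s1) / (t - x) / t - (t * s1 - s2) / (t - x) / x) _ ?_
    rw [pcol_some, pcol_some, pcol_some]
    ext i
    fin_cases i
    · simp
    · simp; field_simp; ring
    · simp; field_simp; ring
    · simp; field_simp; linear_combination (t - x) * h
  -- points `t`, `0`, `∞`
  have zi : ∀ t : F, t ≠ 0 → s2 = t * s1 →
      ∃ T : Finset (Option F), T.card ≤ 3 ∧ ![s0, s1, s2, s3] ∈ spT F T := by
    intro t ht h
    exact inf t 0 ht (by rw [h]; ring)
  by_cases h12 : s1 = 0 ∧ s2 = 0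
  · exact zi 1 one_ne_zero (by rw [h12.1, h12.2]; ring)
  by_cases hz : s1 ≠ 0 ∧ s2 ≠ 0
  · exact zi (s2 / s1) (div_ne_zero hz.2 hz.1) (by field_simp [hz.1])
  obtain ⟨w, hw0, hw1⟩ := exists_ne2 F hq3 1
  by_cases hs1 : s1 = 0
  · -- s2 ≠ 0
    have hs2 : s2 ≠ 0 := fun h => h12 ⟨hs1, h⟩
    by_cases h0 : s0 = 0
    · -- distinct with sum `s3 / s2`
      by_cases hc : s3 = 0
      · by_cases h2 : (2 : F) = 0
        · refine comb_mem F (some 1) (some w) (some (w + 1)) (s2 / ((w + 1) * w)) (s2 / (w + 1))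
            (s2 / w) _ ?_
          have hw2 : w + 1 ≠ 0 := by
            intro h; apply hw1; linear_combination (w - 1) * h
          rw [pcol_some, pcol_some, pcol_some, h0, hs1, hc]
          ext i
          fin_cases i
          · simp; field_simp; linear_combination (-s2 * (1 + w)) * h2
          · simp; field_simp; linear_combination (-s2 * (1 + w + w ^ 2)) * h2
          · simp; field_simp; linear_combination (-(1 + w + w ^ 2 + w ^ 3)) * h2
          · simp; field_simp
            linear_combination (-s2 * (1 + 2 * w + 3 * w ^ 2 + 2 * w ^ 3 + w ^ 4)) * h2
        · refine zer 1 (-1) ?_ one_ne_zero (neg_ne_zero.2 one_ne_zero) (by rw [hc, hs1]; ring)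
          intro h; apply h2; linear_combination h
      · obtain ⟨t, ht0, htc, ht2⟩ : ∃ t : F, t ≠ 0 ∧ t ≠ s3 / s2 ∧ 2 * t ≠ s3 / s2 :=
          exists_half F hq3 _ (div_ne_zero hc hs2)
        refine zer t (s3 / s2 - t) ?_ ht0 (sub_ne_zero.2 htc.symm) ?_
        · intro h; apply ht2; linear_combination h
        · rw [hs1]; field_simp; ring
    · obtain ⟨a, ha, ha2⟩ := exists_ne2 F hq3 (-s2 / s0)
      refine inf a (-s2 / s0 / a) ?_ ?_
      · intro h; apply ha2; rw [sq]; nth_rw 2 [h]; field_simp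
      · rw [hs1]; field_simp; ring
  · have hs2 : s2 = 0 := by by_contra h; exact hz ⟨hs1, h⟩
    by_cases h3 : s3 = 0
    · by_cases h0 : s0 = 0
      · by_cases h2 : (2 : F) = 0
        · have hw2 : w + 1 ≠ 0 := by
            intro h; apply hw1; linear_combination (w - 1) * h
          refine comb_mem F (some 1) (some (1 / w)) (some (1 / (w + 1))) (s1 / ((w + 1) * w))
            (s1 / (w + 1) * w ^ 3) (s1 / w * (w + 1) ^ 3) _ ?_
          rw [pcol_some, pcol_some, pcol_some, h0, hs2, h3]
          ext i
          fin_cases i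
          · simp; field_simp
            linear_combination (-s1 * (1 + 2 * w + 3 * w ^ 2 + 2 * w ^ 3 + w ^ 4)) * h2
          · simp; field_simp; linear_combination (-(1 + w + w ^ 2 + w ^ 3)) * h2
          · simp; field_simp; linear_combination (-s1 * (1 + w + w ^ 2)) * h2
          · simp; field_simp; linear_combination (-s1 * (1 + w)) * h2
        · refine inf 1 (-1) ?_ (by rw [h0, hs2]; ring)
          intro h; apply h2; linear_combination h
      · obtain ⟨t, ht0, htc, ht2⟩ : ∃ t : F, t ≠ 0 ∧ t ≠ s0 / s1 ∧ 2 * t ≠ s0 / s1 :=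
          exists_half F hq3 _ (div_ne_zero h0 hs1)
        have htc' : s0 / s1 - t ≠ 0 := sub_ne_zero.2 htc.symm
        refine inf (1 / t) (1 / (s0 / s1 - t)) ?_ ?_
        · intro h
          apply ht2
          rw [one_div, one_div, inv_inj] at h
          linear_combination h
        · have hx : s0 = s1 * (t + (s0 / s1 - t)) := by field_simp; ring
          generalize s0 / s1 - t = u at *
          rw [hs2, hx]; field_simp; ring
    · obtain ⟨a, ha, ha2⟩ := exists_ne2 F hq3 (-s3 / s1)
      refine zer a (-s3 / s1 / a) ?_ ha ?_ ?_
      · intro h; apply ha2; rw [sq]; nth_rw 2 [h]; field_simp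
      · exact div_ne_zero (div_ne_zero (neg_ne_zero.2 h3) hs1) ha
      · rw [hs2]; field_simp; ring

theorem card_span_eq (F : Type) [Field F] [Fintype F] (m : ℕ) (S : Submodule F (Fin 4 → F)) :
    (Nat.card {w : Fin m → (Fin 4 → F) // span F (Set.range w) = S} : ℚ)
      = ∏ i ∈ Finset.range (finrank F S), ((Fintype.card F : ℚ) ^ m - (Fintype.card F : ℚ) ^ i) := by
  classical
  set d := finrank F S with hd
  let b : Basis (Fin d) F S := finBasis F S
  let f : (Fin d → F) →ₗ[F] (Fin 4 → F) := S.subtype ∘ₗ b.equivFun.symm.toLinearMap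
  have hf : Function.Injective f := by
    intro x y hxy
    exact b.equivFun.symm.injective (Subtype.ext hxy)
  have hfr : LinearMap.range f = S := by
    simp [f, LinearMap.range_comp]
  let E : (Fin d → Fin m → F) → (Fin m → (Fin 4 → F)) := fun k j => f (fun i => k i j)
  have hE : ∀ k, span F (Set.range (E k)) = (span F (Set.range (fun j i => k i j))).map f := by
    intro k
    rw [Submodule.map_span, ← Set.range_comp]; rfl
  have hk : ∀ k : Fin d → Fin m → F, LinearIndependent F k ↔ span F (Set.range (E k)) = S := by
    intro k
    have h1 : finrank F (span F (Set.range (E k))) = finrank F (span F (Set.range k)) := by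
      rw [hE, ← (Submodule.equivMapOfInjective f hf _).finrank_eq]
      have h2 := (Matrix.of k).rank_eq_finrank_span_cols
      have h3 := (Matrix.of k).rank_eq_finrank_span_row
      exact h2.symm.trans h3
    have hle : span F (Set.range (E k)) ≤ S := by
      rw [hE, ← hfr]; exact LinearMap.map_le_range
    rw [linearIndependent_iff_card_eq_finrank_span, Fintype.card_fin, Set.finrank, ← h1]
    constructor
    · intro h; exact Submodule.eq_of_le_of_finrank_eq hle (by rw [← h])
    · intro h; rw [h]
  have hcard : Nat.card {w : Fin m → (Fin 4 → F) // span F (Set.range w) = S}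
      = Nat.card {k : Fin d → Fin m → F // LinearIndependent F k} := by
    symm
    apply Nat.card_congr
    refine Equiv.ofBijective (fun k => ⟨E k.1, (hk k.1).1 k.2⟩) ⟨?_, ?_⟩
    · intro k l h
      have h' : E k.1 = E l.1 := congrArg Subtype.val h
      apply Subtype.ext
      funext i j
      exact congrFun (hf (congrFun h' j)) i
    · rintro ⟨w, hw⟩
      have : ∀ j, ∃ x, f x = w j := by
        intro j
        have : w j ∈ LinearMap.range f := by
          rw [hfr, ← hw]; exact subset_span ⟨j, rfl⟩
        exact this
      choose x hx using this
      have hEx : E (fun i j => x j i) = w := by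
        funext j; exact hx j
      exact ⟨⟨fun i j => x j i, (hk _).2 (by rw [hEx, hw])⟩, Subtype.ext hEx⟩
  rw [hcard]
  by_cases hdm : d ≤ m
  · rw [card_linearIndependent (by simpa using hdm)]
    rw [Finset.prod_range]
    push_cast
    apply Finset.prod_congr rfl
    intro i _
    rw [Nat.cast_sub]
    · simp
    · rw [Module.finrank_fin_fun]
      exact Nat.pow_le_pow_right Fintype.card_pos (by omega)
  · have : IsEmpty {k : Fin d → Fin m → F // LinearIndependent F k} := by
      refine ⟨fun k => hdm ?_⟩
      simpa using k.2.fintype_card_le_finrank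
    rw [Nat.card_of_isEmpty, Nat.cast_zero]
    symm
    apply Finset.prod_eq_zero (i := m) (Finset.mem_range.2 (by omega))
    simp

instance submodFintype (F : Type) [Field F] [Fintype F] : Fintype (Submodule F (Fin 4 → F)) :=
  Fintype.ofFinite _

open Classical in
theorem count_span (F : Type) [Field F] [Fintype F] (m : ℕ) (P : Submodule F (Fin 4 → F) → Prop) :
    (Nat.card {w : Fin m → (Fin 4 → F) // P (span F (Set.range w))} : ℚ)
      = ∑ S : Submodule F (Fin 4 → F) with P S, ∏ i ∈ Finset.range (finrank F S),
          ((Fintype.card F : ℚ) ^ m - (Fintype.card F : ℚ) ^ i) := by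
  rw [Nat.card_eq_fintype_card, Fintype.card_subtype,
    Finset.card_eq_sum_card_fiberwise (f := fun w => span F (Set.range w))
      (t := Finset.univ.filter P) (by intro w hw; simpa using hw)]
  push_cast
  apply Finset.sum_congr rfl
  intro S hS
  rw [← card_span_eq, Nat.card_eq_fintype_card, Fintype.card_subtype, Finset.filter_filter]
  congr 2
  ext w
  simp only [Finset.mem_filter, Finset.mem_univ, true_and] at hS ⊢
  constructor
  · exact fun h => h.2
  · intro h; exact ⟨by rw [h]; exact hS, h⟩

/-- Weight-three condition on a subspace. -/
def GoodS (F : Type) [Field F] (S : Submodule F (Fin 4 → F)) : Prop :=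
  (∃ T : Finset (Option F), T.card ≤ 3 ∧ S ≤ spT F T) ∧
  ¬ (∃ T : Finset (Option F), T.card ≤ 2 ∧ S ≤ spT F T)

theorem GoodS.finrank_pos {F : Type} [Field F] {S : Submodule F (Fin 4 → F)} (h : GoodS F S) :
    0 < finrank F S := by
  rw [pos_iff_ne_zero]
  intro h0
  rw [Submodule.finrank_eq_zero] at h0
  exact h.2 ⟨∅, by simp, by simp [h0]⟩

theorem GoodS.finrank_le {F : Type} [Field F] {S : Submodule F (Fin 4 → F)} (h : GoodS F S) :
    finrank F S ≤ 3 := by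
  obtain ⟨T, hT, hS⟩ := h.1
  exact (Submodule.finrank_mono hS).trans ((finrank_spT_le F T).trans hT)

open Classical in
/-- number of good subspaces of dimension `d` -/
def nGood (F : Type) [Field F] [Fintype F] (d : ℕ) : ℕ :=
  (Finset.univ.filter (fun S : Submodule F (Fin 4 → F) => GoodS F S ∧ finrank F S = d)).card

open Classical in
theorem count_good (F : Type) [Field F] [Fintype F] (m : ℕ) (q : ℚ) (hq : q = Fintype.card F) :
    (Nat.card {w : Fin m → (Fin 4 → F) // GoodS F (span F (Set.range w))} : ℚ)
      = nGood F 1 * (q ^ m - 1) + nGood F 2 * ((q ^ m - 1) * (q ^ m - q))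
        + nGood F 3 * ((q ^ m - 1) * (q ^ m - q) * (q ^ m - q ^ 2)) := by
  rw [count_span, ← hq]
  rw [← Finset.sum_fiberwise_of_maps_to (t := ({1, 2, 3} : Finset ℕ)) (g := fun S : Submodule F (Fin 4 → F) => finrank F S)]
  · rw [Finset.sum_insert (by simp), Finset.sum_insert (by simp), Finset.sum_singleton, ← add_assoc]
    have key : ∀ d, (∑ S ∈ (Finset.univ.filter (GoodS F)).filter (fun S : Submodule F (Fin 4 → F) => finrank F S = d),
        ∏ i ∈ Finset.range (finrank F S), (q ^ m - q ^ i)) =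
        nGood F d * ∏ i ∈ Finset.range d, (q ^ m - q ^ i) := by
      intro d
      rw [Finset.sum_congr rfl (g := fun _ => ∏ i ∈ Finset.range d, (q ^ m - q ^ i))]
      · rw [Finset.sum_const, Finset.filter_filter, nsmul_eq_mul, nGood]
      · intro S hS; rw [(Finset.mem_filter.1 hS).2]
    rw [key, key, key]
    simp [Finset.prod_range_succ]
  · intro S hS
    have h : GoodS F S := by simpa using hS
    have h1 := h.finrank_pos
    have h2 := h.finrank_le
    simp only [Finset.mem_insert, Finset.mem_singleton]
    omega
theorem exists_card3 (F : Type) [Field F] [Fintype F] (hq3 : 3 < Fintype.card F)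
    (T : Finset (Option F)) (hT : T.card ≤ 3) : ∃ U, T ⊆ U ∧ U.card = 3 := by
  obtain ⟨U, h1, -, h2⟩ := Finset.exists_subsuperset_card_eq (Finset.subset_univ T) hT
    (by rw [Finset.card_univ, Fintype.card_option]; omega)
  exact ⟨U, h1, h2⟩

theorem nGood3 (F : Type) [Field F] [Fintype F] (hq3 : 3 < Fintype.card F) :
    nGood F 3 = (Fintype.card F + 1).choose 3 := by
  classical
  have h1 : (Finset.univ.filter (fun S : Submodule F (Fin 4 → F) => GoodS F S ∧ finrank F S = 3))
      = (Finset.powersetCard 3 (Finset.univ : Finset (Option F))).image (spT F) := by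
    ext S
    simp only [Finset.mem_filter, Finset.mem_univ, true_and, Finset.mem_image,
      Finset.mem_powersetCard, Finset.subset_univ]
    constructor
    · rintro ⟨hg, hS⟩
      obtain ⟨T, hT, hST⟩ := hg.1
      obtain ⟨U, hTU, hU⟩ := exists_card3 F hq3 T hT
      refine ⟨U, hU, ?_⟩
      symm
      apply Submodule.eq_of_le_of_finrank_eq (hST.trans (spT_mono F hTU))
      rw [hS, finrank_spT F U (by omega), hU]
    · rintro ⟨T, hT, rfl⟩
      have hf : finrank F (spT F T) = 3 := by rw [finrank_spT F T (by omega), hT]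
      refine ⟨⟨⟨T, hT.le, le_rfl⟩, ?_⟩, hf⟩
      rintro ⟨U, hU, hle⟩
      have := Submodule.finrank_mono hle
      have := finrank_spT_le F U
      omega
  have e : nGood F 3 = ((Finset.powersetCard 3 (Finset.univ : Finset (Option F))).image
      (spT F)).card := by
    rw [← h1, nGood]
  rw [e, Finset.card_image_of_injOn, Finset.card_powersetCard, Finset.card_univ,
    Fintype.card_option]
  intro T hT U hU h
  have hT' := (Finset.mem_powersetCard.1 hT).2
  have hU' := (Finset.mem_powersetCard.1 hU).2
  ext t
  rw [← pcol_mem_iff F t T (by omega), ← pcol_mem_iff F t U (by omega), h]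

/-- coordinate reversal -/
def revE (F : Type) [Field F] : (Fin 4 → F) ≃ₗ[F] (Fin 4 → F) :=
  LinearEquiv.funCongrLeft F F Fin.revPerm

theorem revE_some (F : Type) [Field F] (t : F) :
    revE F (pcol F (some t)) = ![t ^ 3, t ^ 2, t, 1] := by
  rw [pcol_some]; ext i; fin_cases i <;> rfl

theorem revE_none (F : Type) [Field F] :
    revE F (pcol F none) = ![1, 0, 0, 0] := by
  rw [pcol_none]; ext i; fin_cases i <;> rfl

/-- cubic point with parameter `t` -/
def cpt (F : Type) [Field F] (t : Option F) : Submodule F (Fin 4 → F) :=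
  span F {revE F (pcol F t)}

theorem mem_cubicPts (F : Type) [Field F] (P : Submodule F (Fin 4 → F)) :
    P ∈ cubicPts F ↔ ∃ t, P = cpt F t := by
  constructor
  · rintro (⟨t, rfl⟩ | rfl)
    · exact ⟨some t, by rw [cpt, revE_some]⟩
    · exact ⟨none, by rw [cpt, revE_none]⟩
  · rintro ⟨t, rfl⟩
    cases t with
    | some t => left; exact ⟨t, by rw [cpt, revE_some]⟩
    | none => right; rw [cpt, revE_none]

theorem cpt_le (F : Type) [Field F] (t : Option F) (S : Submodule F (Fin 4 → F)) :
    cpt F t ≤ S.map (revE F).toLinearMap ↔ pcol F t ∈ S := by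
  rw [cpt, span_singleton_le_iff_mem]
  exact (revE F).injective.mem_set_image (s := (S : Set (Fin 4 → F)))

theorem cpt_inj (F : Type) [Field F] : Function.Injective (cpt F) := by
  intro s t h
  have h1 : cpt F t = (spT F {t}).map (revE F).toLinearMap := by
    rw [cpt, spT, Submodule.map_span]; simp
  have h2 : cpt F s ≤ (spT F {t}).map (revE F).toLinearMap := by rw [h, h1]
  rw [cpt_le, pcol_mem_iff F s {t} (by simp)] at h2
  simpa using h2

theorem finrank_rev (F : Type) [Field F] (S : Submodule F (Fin 4 → F)) :
    finrank F (S.map (revE F).toLinearMap) = finrank F S := LinearEquiv.finrank_map_eq (revE F) S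

theorem ptsOn_rev (F : Type) [Field F] (S : Submodule F (Fin 4 → F)) :
    ptsOn F (S.map (revE F).toLinearMap) = cpt F '' {t | pcol F t ∈ S} := by
  ext P
  simp only [ptsOn, Set.mem_ofPred_eq, Set.mem_image, mem_cubicPts]
  constructor
  · rintro ⟨⟨t, rfl⟩, h⟩
    exact ⟨t, (cpt_le F t S).1 h, rfl⟩
  · rintro ⟨t, h, rfl⟩
    exact ⟨⟨t, rfl⟩, (cpt_le F t S).2 h⟩

theorem threePlane_rev (F : Type) [Field F] [Fintype F] (S : Submodule F (Fin 4 → F)) :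
    IsThreePlane F (S.map (revE F).toLinearMap) ↔ ∃ T : Finset (Option F), T.card = 3 ∧ S = spT F T := by
  classical
  rw [IsThreePlane, finrank_rev, ptsOn_rev, Set.ncard_image_of_injective _ (cpt_inj F)]
  constructor
  · rintro ⟨h1, h2⟩
    refine ⟨Finset.univ.filter (fun t => pcol F t ∈ S), ?_, ?_⟩
    · rw [← h2, ← Set.ncard_coe_finset]; simp
    · have hc : (Finset.univ.filter (fun t => pcol F t ∈ S)).card = 3 := by
        rw [← h2, ← Set.ncard_coe_finset]; simp
      symm
      apply Submodule.eq_of_le_of_finrank_eq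
      · rw [spT, span_le]
        rintro _ ⟨t, ht, rfl⟩
        simpa using ht
      · rw [finrank_spT F _ (by omega), hc, h1]
  · rintro ⟨T, hT, rfl⟩
    refine ⟨by rw [finrank_spT F T (by omega), hT], ?_⟩
    have : {t | pcol F t ∈ spT F T} = (T : Set (Option F)) := by
      ext t; exact pcol_mem_iff F t T (by omega)
    rw [this, Set.ncard_coe_finset, hT]

theorem chord_rev (F : Type) [Field F]
    (S : Submodule F (Fin 4 → F)) (hS : finrank F S = 2) :
    IsRealChord F (S.map (revE F).toLinearMap) ↔
      ∃ T : Finset (Option F), T.card ≤ 2 ∧ S ≤ spT F T := by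
  classical
  rw [IsRealChord, finrank_rev]
  constructor
  · rintro ⟨-, P, Q, hP, hQ, hne, h1, h2⟩
    obtain ⟨a, rfl⟩ := (mem_cubicPts F P).1 hP
    obtain ⟨b, rfl⟩ := (mem_cubicPts F Q).1 hQ
    have hab : a ≠ b := fun h => hne (by rw [h])
    rw [cpt_le] at h1 h2
    have hc : ({a, b} : Finset (Option F)).card = 2 := Finset.card_pair hab
    refine ⟨{a, b}, hc.le, ?_⟩
    apply le_of_eq
    symm
    apply Submodule.eq_of_le_of_finrank_eq
    · rw [spT, span_le]
      rintro _ ⟨t, ht, rfl⟩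
      simp only [Finset.coe_insert, Finset.coe_singleton, Set.mem_insert_iff,
        Set.mem_singleton_iff] at ht
      rcases ht with rfl | rfl
      · exact h1
      · exact h2
    · rw [finrank_spT F _ (by omega), hc, hS]
  · rintro ⟨T, hT, hle⟩
    have h1 := Submodule.finrank_mono hle
    have h2 := finrank_spT F T (by omega)
    have hT2 : T.card = 2 := by omega
    have he : S = spT F T := Submodule.eq_of_le_of_finrank_eq hle (by omega)
    obtain ⟨a, b, hab, rfl⟩ := Finset.card_eq_two.1 hT2
    refine ⟨hS, cpt F a, cpt F b, (mem_cubicPts F _).2 ⟨a, rfl⟩, (mem_cubicPts F _).2 ⟨b, rfl⟩,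
      fun h => hab (cpt_inj F h), ?_, ?_⟩
    · rw [cpt_le, he]; exact pcol_mem F (by simp)
    · rw [cpt_le, he]; exact pcol_mem F (by simp)

theorem nGood2 (F : Type) [Field F] [Fintype F] (hq3 : 3 < Fintype.card F) :
    nGood F 2 = (muSet F).ncard := by
  classical
  have hinj : Function.Injective
      (fun S : Submodule F (Fin 4 → F) => S.map (revE F).toLinearMap) :=
    Submodule.map_injective_of_injective (revE F).injective
  have hsurj : ∀ S : Submodule F (Fin 4 → F), ∃ S' : Submodule F (Fin 4 → F), S = S'.map (revE F).toLinearMap := by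
    intro S
    exact ⟨S.comap (revE F).toLinearMap,
      (Submodule.map_comap_eq_of_surjective (revE F).surjective S).symm⟩
  have h : muSet F = (fun S : Submodule F (Fin 4 → F) => S.map (revE F).toLinearMap) ''
      ((Finset.univ.filter (fun S : Submodule F (Fin 4 → F) => GoodS F S ∧ finrank F S = 2) :
        Finset _) : Set (Submodule F (Fin 4 → F))) := by
    ext L
    obtain ⟨S, rfl⟩ := hsurj L
    have hm : (S.map (revE F).toLinearMap ∈
      (fun S : Submodule F (Fin 4 → F) => S.map (revE F).toLinearMap) ''
      ((Finset.univ.filter (fun S : Submodule F (Fin 4 → F) => GoodS F S ∧ finrank F S = 2) :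
        Finset _) : Set (Submodule F (Fin 4 → F)))) ↔ GoodS F S ∧ finrank F S = 2 := by
      rw [hinj.mem_set_image (a := S)]
      simp
    rw [hm, muSet, Set.mem_ofPred_eq, finrank_rev]
    constructor
    · rintro ⟨h2, hch, W, hW, hLW⟩
      obtain ⟨W, rfl⟩ := hsurj W
      rw [threePlane_rev] at hW
      obtain ⟨T, hT, rfl⟩ := hW
      refine ⟨⟨⟨T, hT.le, ?_⟩, ?_⟩, h2⟩
      · exact (Submodule.map_le_map_iff_of_injective (revE F).injective _ _).1 hLW
      · rwa [← chord_rev F S h2]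
    · rintro ⟨hg, h2⟩
      refine ⟨h2, ?_, ?_⟩
      · rw [chord_rev F S h2]; exact hg.2
      · obtain ⟨T, hT, hST⟩ := hg.1
        obtain ⟨U, hTU, hU⟩ := exists_card3 F hq3 T hT
        exact ⟨_, (threePlane_rev F (spT F U)).2 ⟨U, hU, rfl⟩,
          Submodule.map_mono (hST.trans (spT_mono F hTU))⟩
  rw [h, Set.ncard_image_of_injective _ hinj, Set.ncard_coe_finset, nGood]

theorem mem_spT_iff (F : Type) [Field F] [Fintype F] (T : Finset (Option F)) (v : Fin 4 → F) :
    v ∈ spT F T ↔ ∃ c : Option F → F, (∀ t, t ∉ T → c t = 0) ∧ ∑ t, c t • pcol F t = v := by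
  classical
  constructor
  · intro h
    rw [spT, Submodule.mem_span_image_finset_iff_exists_fun'] at h
    obtain ⟨c, hc⟩ := h
    refine ⟨fun t => if t ∈ T then c t else 0, fun t ht => if_neg ht, ?_⟩
    rw [← hc, ← Finset.sum_subset (Finset.subset_univ T)]
    · apply Finset.sum_congr rfl
      intro t ht; simp [ht]
    · intro t _ ht; simp [ht]
  · rintro ⟨c, hc, rfl⟩
    apply Submodule.sum_mem
    intro t _
    by_cases ht : t ∈ T
    · exact Submodule.smul_mem _ _ (pcol_mem F ht)
    · rw [hc t ht, zero_smul]; exact Submodule.zero_mem _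

open Classical in
theorem card_supp (α F : Type) [Fintype α] [Field F] [Fintype F] (k : ℕ) :
    (Finset.univ.filter (fun c : α → F => (Finset.univ.filter (fun t => c t ≠ 0)).card = k)).card
      = (Fintype.card α).choose k * (Fintype.card F - 1) ^ k := by
  rw [Finset.card_eq_sum_card_fiberwise (f := fun c => Finset.univ.filter (fun t => c t ≠ 0))
    (t := Finset.powersetCard k Finset.univ) (by intro c hc; simpa [Finset.mem_powersetCard] using hc)]
  rw [Finset.sum_congr rfl (g := fun _ => (Fintype.card F - 1) ^ k), Finset.sum_const,
    Finset.card_powersetCard, Finset.card_univ, smul_eq_mul]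
  intro T hT
  have hT' := (Finset.mem_powersetCard.1 hT).2
  have : (Finset.univ.filter (fun c : α → F => (Finset.univ.filter (fun t => c t ≠ 0)).card = k)).filter
      (fun c => Finset.univ.filter (fun t => c t ≠ 0) = T)
      = Fintype.piFinset (fun t => if t ∈ T then Finset.univ.erase (0 : F) else {0}) := by
    ext c
    simp only [Finset.mem_filter, Finset.mem_univ, true_and, Fintype.mem_piFinset]
    constructor
    · rintro ⟨-, h⟩ t
      rw [Finset.ext_iff] at h
      have := h t
      simp only [Finset.mem_filter, Finset.mem_univ, true_and] at this
      split_ifs with ht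
      · simpa using this.2 ht
      · simpa using not_not.1 (fun hh => ht (this.1 hh))
    · intro h
      have h' : Finset.univ.filter (fun t => c t ≠ 0) = T := by
        ext t
        have := h t
        simp only [Finset.mem_filter, Finset.mem_univ, true_and]
        split_ifs at this with ht
        · simpa [ht] using this
        · simpa [ht] using this
      exact ⟨by rw [h', hT'], h'⟩
  rw [this, Fintype.card_piFinset]
  have e : ∀ t, (if t ∈ T then Finset.univ.erase (0 : F) else {0}).card
      = if t ∈ T then Fintype.card F - 1 else 1 := by
    intro t; split_ifs
    · rw [Finset.card_erase_of_mem (Finset.mem_univ _), Finset.card_univ]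
    · simp
  simp_rw [e]
  rw [Finset.prod_ite_mem, Finset.univ_inter, Finset.prod_const, hT']

open Classical in
theorem card_light (α F : Type) [Fintype α] [Field F] [Fintype F] :
    (Finset.univ.filter (fun c : α → F => (Finset.univ.filter (fun t => c t ≠ 0)).card ≤ 2)).card
      = ∑ k ∈ Finset.range 3, (Fintype.card α).choose k * (Fintype.card F - 1) ^ k := by
  rw [Finset.card_eq_sum_card_fiberwise
    (f := fun c : α → F => (Finset.univ.filter (fun t => c t ≠ 0)).card)
    (t := Finset.range 3) (by intro c hc; simp at hc ⊢; omega)]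
  apply Finset.sum_congr rfl
  intro k hk
  rw [← card_supp, Finset.filter_filter]
  congr 1
  ext c
  have := Finset.mem_range.1 hk
  simp only [Finset.mem_filter, Finset.mem_univ, true_and]
  omega

open Classical in
theorem card_light_vec (F : Type) [Field F] [Fintype F] :
    (Finset.univ.filter (fun v : Fin 4 → F =>
        ∃ T : Finset (Option F), T.card ≤ 2 ∧ v ∈ spT F T)).card
      = ∑ k ∈ Finset.range 3, (Fintype.card F + 1).choose k * (Fintype.card F - 1) ^ k := by
  rw [← Fintype.card_option, ← card_light (Option F) F]
  symm
  apply Finset.card_bij (fun c _ => ∑ t, c t • pcol F t)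
  · intro c hc
    simp only [Finset.mem_filter, Finset.mem_univ, true_and] at hc ⊢
    refine ⟨_, hc, (mem_spT_iff F _ _).2 ⟨c, ?_, rfl⟩⟩
    intro t ht
    simpa using ht
  · intro c hc d hd h
    simp only [Finset.mem_filter, Finset.mem_univ, true_and] at hc hd
    set U := Finset.univ.filter (fun t => c t ≠ 0) ∪ Finset.univ.filter (fun t => d t ≠ 0) with hU
    have hUc : U.card ≤ 4 := (Finset.card_union_le _ _).trans (by omega)
    have hin := linearIndepOn_finset_iff.1 (indepT F U hUc) (fun t => c t - d t) (by
      rw [Finset.sum_subset (Finset.subset_univ U)]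
      · simp_rw [sub_smul]
        rw [Finset.sum_sub_distrib, h, sub_self]
      · intro t _ ht
        simp only [hU, Finset.mem_union, Finset.mem_filter, Finset.mem_univ, true_and, not_or,
          not_not] at ht
        rw [ht.1, ht.2, sub_self, zero_smul])
    funext t
    by_cases ht : t ∈ U
    · exact sub_eq_zero.1 (hin t ht)
    · simp only [hU, Finset.mem_union, Finset.mem_filter, Finset.mem_univ, true_and, not_or,
          not_not] at ht
      rw [ht.1, ht.2]
  · intro v hv
    simp only [Finset.mem_filter, Finset.mem_univ, true_and] at hv
    obtain ⟨T, hT, hv⟩ := hv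
    obtain ⟨c, hc, rfl⟩ := (mem_spT_iff F T v).1 hv
    refine ⟨c, ?_, rfl⟩
    simp only [Finset.mem_filter, Finset.mem_univ, true_and]
    refine (Finset.card_le_card ?_).trans hT
    intro t ht
    by_contra hn
    simp [hc t hn] at ht

theorem nGood1 (F : Type) [Field F] [Fintype F] (hq3 : 3 < Fintype.card F) (q : ℚ)
    (hq : q = Fintype.card F) :
    (nGood F 1 : ℚ) = 1 / 2 * q * (q + 1) ^ 2 := by
  classical
  have h1 := count_good F 1 q hq
  have h2 : Nat.card {w : Fin 1 → (Fin 4 → F) // GoodS F (span F (Set.range w))}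
      = (Finset.univ.filter (fun v : Fin 4 → F =>
        ¬ ∃ T : Finset (Option F), T.card ≤ 2 ∧ v ∈ spT F T)).card := by
    rw [← Fintype.card_subtype, ← Nat.card_eq_fintype_card]
    apply Nat.card_congr
    refine (Equiv.funUnique (Fin 1) (Fin 4 → F)).subtypeEquiv ?_
    intro w
    have hr : Set.range w = {w 0} := by
      ext x; simp [Fin.exists_fin_one, eq_comm]
    rw [hr]
    simp only [GoodS, span_singleton_le_iff_mem]
    have := coverT F hq3 (w 0)
    simp only [this, true_and]
    rfl
  have h3 := Finset.card_filter_add_card_filter_not (s := (Finset.univ : Finset (Fin 4 → F)))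
    (fun v : Fin 4 → F => ∃ T : Finset (Option F), T.card ≤ 2 ∧ v ∈ spT F T)
  rw [card_light_vec F, ← h2, Finset.card_univ, Fintype.card_fun, Fintype.card_fin] at h3
  have h4 := congrArg (Nat.cast : ℕ → ℚ) h3
  push_cast at h4
  rw [h1, Finset.sum_range_succ, Finset.sum_range_succ, Finset.sum_range_one,
    Nat.cast_sub (by omega), Nat.cast_choose_two] at h4
  push_cast at h4
  simp only [← hq, Nat.choose_zero_right, Nat.choose_one_right] at h4
  push_cast at h4
  rw [← hq] at h4
  have hq1 : q - 1 ≠ 0 := by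
    rw [hq]
    have : (3 : ℚ) < Fintype.card F := by exact_mod_cast hq3
    intro h; linarith
  apply mul_right_cancel₀ hq1
  linear_combination h4

/-- coordinates of the syndrome with respect to a basis of `K` over `F` -/
def synF (F : Type) [Field F] [Fintype F] (K : Type) [Field K] [Algebra F K] {m : ℕ}
    (b : Basis (Fin m) F K) (v : Option F → K) : Fin m → (Fin 4 → F) :=
  fun j => ∑ t, (b.repr (v t) j) • pcol F t

theorem synF_eq (F : Type) [Field F] [Fintype F] (K : Type) [Field K] [Algebra F K] {m : ℕ}
    (b : Basis (Fin m) F K) (v : Option F → K) (j : Fin m) (i : Fin 4) :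
    synF F K b v j i = b.repr ((((Hmat F).map (algebraMap F K)).mulVec v) i) j := by
  have : (((Hmat F).map (algebraMap F K)).mulVec v) i = ∑ t, Hmat F i t • v t := by
    simp [Matrix.mulVec, dotProduct, Algebra.smul_def]
  rw [this]
  simp [synF, pcol, Finset.sum_apply, mul_comm]

theorem synF_eq_iff (F : Type) [Field F] [Fintype F] (K : Type) [Field K] [Algebra F K] {m : ℕ}
    (b : Basis (Fin m) F K) (v v' : Option F → K) :
    synF F K b v = synF F K b v' ↔
      (Submodule.Quotient.mk v : (Option F → K) ⧸ codeC F K) = Submodule.Quotient.mk v' := by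
  rw [Submodule.Quotient.eq, codeC, LinearMap.mem_ker, map_sub, sub_eq_zero,
    Matrix.mulVecLin_apply, Matrix.mulVecLin_apply]
  constructor
  · intro h
    funext i
    apply b.repr.injective
    ext j
    rw [← synF_eq, ← synF_eq, h]
  · intro h
    funext j i
    rw [synF_eq, synF_eq, h]

theorem synF_surj (F : Type) [Field F] [Fintype F] (K : Type) [Field K] [Algebra F K] {m : ℕ}
    (b : Basis (Fin m) F K) (n : ℕ) (w : Fin m → (Fin 4 → F)) :
    (∃ v : Option F → K, synF F K b v = w ∧ {j | v j ≠ 0}.ncard ≤ n) ↔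
      ∃ T : Finset (Option F), T.card ≤ n ∧ span F (Set.range w) ≤ spT F T := by
  classical
  constructor
  · rintro ⟨v, rfl, hn⟩
    refine ⟨Finset.univ.filter (fun j => v j ≠ 0), ?_, ?_⟩
    · rw [← Set.ncard_coe_finset]; simpa using hn
    · rw [span_le]
      rintro _ ⟨j, rfl⟩
      refine (mem_spT_iff F _ _).2 ⟨fun t => b.repr (v t) j, ?_, rfl⟩
      intro t ht
      have : v t = 0 := by simpa using ht
      simp [this]
  · rintro ⟨T, hT, h⟩
    have : ∀ j, ∃ c : Option F → F, (∀ t, t ∉ T → c t = 0) ∧ ∑ t, c t • pcol F t = w j :=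
      fun j => (mem_spT_iff F T (w j)).1 (h (subset_span ⟨j, rfl⟩))
    choose c hc hw using this
    refine ⟨fun t => ∑ j, c j t • b j, ?_, ?_⟩
    · funext j
      rw [← hw j, synF]
      apply Finset.sum_congr rfl
      intro t _
      rw [Basis.repr_sum_self b (fun j => c j t)]
    · refine le_trans ?_ hT
      rw [← Set.ncard_coe_finset]
      apply Set.ncard_le_ncard _ (Finset.finite_toSet T)
      intro t ht
      by_contra hn
      apply ht
      apply Finset.sum_eq_zero
      intro j _
      rw [hc j t (by simpa using hn), zero_smul]

theorem weight_le_iff (F : Type) [Field F] [Fintype F] (K : Type) [Field K] [Algebra F K] {m : ℕ}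
    (b : Basis (Fin m) F K) (n : ℕ) (v : Option F → K) :
    cosetWeight F K (Submodule.Quotient.mk v) ≤ n ↔
      ∃ T : Finset (Option F), T.card ≤ n ∧ span F (Set.range (synF F K b v)) ≤ spT F T := by
  rw [← synF_surj F K b n, cosetWeight]
  simp_rw [synF_eq_iff]
  constructor
  · intro h
    obtain ⟨v', h1, h2⟩ := Nat.sInf_mem (s := {n | ∃ v' : Option F → K,
      (Submodule.Quotient.mk v' : (Option F → K) ⧸ codeC F K) = Submodule.Quotient.mk v ∧
        {j | v' j ≠ 0}.ncard = n}) ⟨_, v, rfl, rfl⟩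
    exact ⟨v', h1, h2.le.trans h⟩
  · rintro ⟨v', h1, h2⟩
    refine le_trans (Nat.sInf_le ?_) h2
    exact ⟨v', h1, rfl⟩

theorem weight_eq_iff (F : Type) [Field F] [Fintype F] (K : Type) [Field K] [Algebra F K] {m : ℕ}
    (b : Basis (Fin m) F K) (v : Option F → K) :
    cosetWeight F K (Submodule.Quotient.mk v) = 3 ↔
      GoodS F (span F (Set.range (synF F K b v))) := by
  rw [GoodS, ← weight_le_iff, ← weight_le_iff]
  omega

theorem card_weight (F : Type) [Field F] [Fintype F] (K : Type) [Field K] [Algebra F K] {m : ℕ}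
    (b : Basis (Fin m) F K) :
    Nat.card {x : (Option F → K) ⧸ codeC F K // cosetWeight F K x = 3} =
      Nat.card {w : Fin m → (Fin 4 → F) // GoodS F (span F (Set.range w))} := by
  have hs := Submodule.Quotient.mk_surjective (codeC F K)
  let r := Function.surjInv hs
  have hr : ∀ x, Submodule.Quotient.mk (r x) = x := Function.surjInv_eq hs
  apply Nat.card_congr
  refine Equiv.ofBijective (fun x => ⟨synF F K b (r x.1), ?_⟩) ⟨?_, ?_⟩
  · rw [← weight_eq_iff, hr]; exact x.2
  · intro x y h
    have h' : synF F K b (r x.1) = synF F K b (r y.1) := congrArg Subtype.val h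
    rw [synF_eq_iff, hr, hr] at h'
    exact Subtype.ext h'
  · rintro ⟨w, hw⟩
    obtain ⟨T, hT⟩ := hw.1
    obtain ⟨v, rfl, -⟩ := (synF_surj F K b 3 w).2 ⟨T, hT⟩
    refine ⟨⟨Submodule.Quotient.mk v, (weight_eq_iff F K b v).2 hw⟩, ?_⟩
    apply Subtype.ext
    exact (synF_eq_iff F K b _ _).2 (hr _)

theorem stmt19 (F : Type) [Field F] [Fintype F] (K : Type) [Field K] [Algebra F K]
    (m : ℕ) (hm : 1 ≤ m) (hK : finrank F K = m)
    (q : ℕ) (hq : q = Fintype.card F) (hq3 : 3 < q) :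
    (Nat.card {x : (Option F → K) ⧸ codeC F K // cosetWeight F K x = 3} : ℚ)
      = ((q : ℚ) ^ m - 1) *
          (1 / 2 * q * (q + 1) ^ 2
            + 1 / 6 * q * (q + 1) * (q - 1) *
                ((q : ℚ) ^ (2 * m) + (q : ℚ) ^ m + 1
                  - (q ^ 2 + q + 1) * ((q : ℚ) ^ m - q + 1))
            + ((muSet F).ncard : ℚ) * ((q : ℚ) ^ m - q)) := by
  have : Module.Finite F K := Module.finite_of_finrank_pos (by omega)
  subst hq
  set q : ℚ := (Fintype.card F : ℚ) with hq
  rw [card_weight F K (finBasisOfFinrankEq F K hK), count_good F m q hq, nGood1 F hq3 q hq,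
    nGood2 F hq3, nGood3 F hq3]
  have h3 : (((Fintype.card F + 1).choose 3 : ℕ) : ℚ) = 1 / 6 * q * (q + 1) * (q - 1) := by
    have h := Nat.descFactorial_eq_factorial_mul_choose (Fintype.card F + 1) 3
    have h' : (Fintype.card F + 1).descFactorial 3
        = (Fintype.card F - 1) * (Fintype.card F * (Fintype.card F + 1)) := by
      simp [Nat.descFactorial]
    rw [h'] at h
    have h4 := congrArg (Nat.cast : ℕ → ℚ) h
    push_cast [Nat.cast_sub (show 1 ≤ Fintype.card F by omega)] at h4
    rw [← hq] at h4
    norm_num [Nat.factorial] at h4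
    linear_combination -(1 / 6) * h4
  rw [h3, pow_mul' q 2 m]
  ring

end
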